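/- Let n ≥ 2, T > 0 and γ ∈ [0,1). Let v : {x ∈ ℝⁿ : xₙ ≥ 0} × (0,T) → ℝ be measurable and locally integrable, such that for each t ∈ (0,T) the function v(·,t) is continuous on the closed half space {xₙ ≥ 0} and satisfies v(x', 0, t) = 0 for all x' ∈ ℝⁿ⁻¹, and sup_{0<t<T} t^γ sup_{x ∈ ℝⁿ₊} |v(x,t)| < ∞. Assume that ∫₀^T ∫_{ℝⁿ₊} v(x,t) ( ∂ₜφ(x,t) + Δφ(x,t) ) dx dt = 0 for every smooth φ : ℝⁿ × ℝ → ℝ whose support is a compact subset of ℝⁿ₊ × (−∞, T). Then v = 0 almost everywhere on ℝⁿ₊ × (0,T). -/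

import Mathlib

open MeasureTheory Set Metric Filter

noncomputable section

abbrev En (n : ℕ) := EuclideanSpace ℝ (Fin n)

/-- the `i`-th standard basis vector of `ℝⁿ`. -/
def eb (n : ℕ) (i : Fin n) : En n := EuclideanSpace.single i 1

/-- the Laplacian `Δf`, computed as the sum of the second derivatives in the
coordinate directions. -/
def vlap {n : ℕ} {F : Type*} [NormedAddCommGroup F] [NormedSpace ℝ F]
    (f : En n → F) (x : En n) : F :=
  ∑ i, fderiv ℝ (fun y => fderiv ℝ f y (eb n i)) x (eb n i)

/-- the divergence `div v = Σⱼ ∂vʲ/∂xⱼ` of a vector field. -/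
def vdiv {n : ℕ} (v : En n → En n) (x : En n) : ℝ :=
  ∑ i, fderiv ℝ v x (eb n i) i

/-- the index of the last coordinate of `ℝⁿ`. -/
def lastIdx (n : ℕ) (hn : 2 ≤ n) : Fin n := ⟨n - 1, by omega⟩

/-- the last coordinate `xₙ` of a point of `ℝⁿ`. -/
def xlast (n : ℕ) (hn : 2 ≤ n) (x : En n) : ℝ := x (lastIdx n hn)

/-- the open upper half space `ℝⁿ₊ = {x : xₙ > 0}`. -/
def openHalf (n : ℕ) (hn : 2 ≤ n) : Set (En n) := {x : En n | 0 < xlast n hn x}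

/-- the closed upper half space `{x : xₙ ≥ 0}`. -/
def closedHalf (n : ℕ) (hn : 2 ≤ n) : Set (En n) := {x : En n | 0 ≤ xlast n hn x}

open scoped Topology ContDiff ENNReal

/-! ### Directional derivatives and the backward heat operator -/

section DirDeriv

variable {F : Type*} [NormedAddCommGroup F] [NormedSpace ℝ F]

/-- The derivative of `f` in the direction `u`, as a function. -/
def dirDeriv (u : F) (f : F → ℝ) : F → ℝ := fun p => fderiv ℝ f p u

lemma ContDiff.dirDeriv {f : F → ℝ} (hf : ContDiff ℝ ∞ f) (u : F) :
    ContDiff ℝ ∞ (dirDeriv u f) :=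
  (hf.fderiv_right (m := ∞) (by simp)).clm_apply contDiff_const

lemma HasCompactSupport.dirDeriv {f : F → ℝ} (hf : HasCompactSupport f) (u : F) :
    HasCompactSupport (dirDeriv u f) :=
  hf.fderiv_apply ℝ u

lemma dirDeriv_mul {f g : F → ℝ} (hf : ContDiff ℝ ∞ f) (hg : ContDiff ℝ ∞ g) (u : F) :
    dirDeriv u (fun p => f p * g p) = fun p => dirDeriv u f p * g p + f p * dirDeriv u g p := by
  funext p
  have hf' := (hf.differentiable (by simp)).differentiableAt (x := p)
  have hg' := (hg.differentiable (by simp)).differentiableAt (x := p)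
  simp only [dirDeriv]
  rw [fderiv_fun_mul hf' hg']
  simp
  ring

lemma dirDeriv_add {f g : F → ℝ} (hf : ContDiff ℝ ∞ f) (hg : ContDiff ℝ ∞ g) (u : F) :
    dirDeriv u (fun p => f p + g p) = fun p => dirDeriv u f p + dirDeriv u g p := by
  funext p
  have hf' := (hf.differentiable (by simp)).differentiableAt (x := p)
  have hg' := (hg.differentiable (by simp)).differentiableAt (x := p)
  simp only [dirDeriv]
  rw [fderiv_fun_add hf' hg']
  simp

end DirDeriv

section HeatOp

variable {n : ℕ}

/-- The spatial directional derivative along the `i`-th coordinate. -/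
abbrev spDeriv (i : Fin n) (f : En n × ℝ → ℝ) : En n × ℝ → ℝ :=
  dirDeriv (eb n i, 0) f

/-- The backward heat operator `∂ₜ + Δ` on functions on `ℝⁿ × ℝ`. -/
def heatOp (f : En n × ℝ → ℝ) (p : En n × ℝ) : ℝ :=
  dirDeriv (0, 1) f p + ∑ i, spDeriv i (spDeriv i f) p

lemma deriv_slice_eq {f : En n × ℝ → ℝ} (hf : ContDiff ℝ ∞ f) (x : En n) (t : ℝ) :
    deriv (fun s => f (x, s)) t = dirDeriv (0, 1) f (x, t) := by
  have h1 : HasDerivAt (fun s : ℝ => (x, s)) ((0 : En n), (1 : ℝ)) t :=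
    (hasDerivAt_const t x).prodMk (hasDerivAt_id t)
  have h2 := ((hf.differentiable (by simp)).differentiableAt (x := (x, t))).hasFDerivAt
  exact (h2.comp_hasDerivAt t h1).deriv

lemma fderiv_slice_eq {f : En n × ℝ → ℝ} (hf : ContDiff ℝ ∞ f) (x u : En n) (t : ℝ) :
    fderiv ℝ (fun y => f (y, t)) x u = dirDeriv (u, 0) f (x, t) := by
  have h1 : HasFDerivAt (fun y : En n => (y, t)) (ContinuousLinearMap.inl ℝ (En n) ℝ) x :=
    hasFDerivAt_prodMk_left x t
  have h2 := ((hf.differentiable (by simp)).differentiableAt (x := (x, t))).hasFDerivAt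
  have h3 := (h2.comp x h1).fderiv
  simp only [Function.comp_def] at h3
  rw [h3]
  rfl

lemma heatOp_eq {f : En n × ℝ → ℝ} (hf : ContDiff ℝ ∞ f) (x : En n) (t : ℝ) :
    deriv (fun s => f (x, s)) t + vlap (fun y => f (y, t)) x = heatOp f (x, t) := by
  simp only [heatOp, vlap, deriv_slice_eq hf, fderiv_slice_eq hf]
  congr 1
  exact Finset.sum_congr rfl fun i _ => fderiv_slice_eq (hf.dirDeriv _) x _ t

lemma ContDiff.heatOp {f : En n × ℝ → ℝ} (hf : ContDiff ℝ ∞ f) :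
    ContDiff ℝ ∞ (heatOp f) := by
  unfold _root_.heatOp
  exact (hf.dirDeriv _).add (ContDiff.sum fun i _ => (hf.dirDeriv _).dirDeriv _)

lemma tsupport_dirDeriv_subset {F : Type*} [NormedAddCommGroup F] [NormedSpace ℝ F] (u : F)
    (f : F → ℝ) : tsupport (dirDeriv u f) ⊆ tsupport f :=
  tsupport_fderiv_apply_subset ℝ u

lemma heatOp_eq_zero_of_notMem {f : En n × ℝ → ℝ} {p : En n × ℝ} (hp : p ∉ tsupport f) :
    heatOp f p = 0 := by
  have key : ∀ u (g : En n × ℝ → ℝ), p ∉ tsupport g → p ∉ tsupport (dirDeriv u g) :=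
    fun u g h h' => h (tsupport_dirDeriv_subset u g h')
  simp only [heatOp]
  rw [image_eq_zero_of_notMem_tsupport (key _ _ hp), Finset.sum_eq_zero, add_zero]
  exact fun i _ => image_eq_zero_of_notMem_tsupport (key _ _ (key _ _ hp))

lemma HasCompactSupport.heatOp {f : En n × ℝ → ℝ} (hf : HasCompactSupport f) :
    HasCompactSupport (heatOp f) :=
  HasCompactSupport.intro hf.isCompact fun _ hp => heatOp_eq_zero_of_notMem hp

lemma heatOp_mul {f g : En n × ℝ → ℝ} (hf : ContDiff ℝ ∞ f) (hg : ContDiff ℝ ∞ g)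
    (p : En n × ℝ) :
    heatOp (fun q => f q * g q) p = f p * heatOp g p + heatOp f p * g p
      + 2 * ∑ i, spDeriv i f p * spDeriv i g p := by
  simp only [heatOp, spDeriv, dirDeriv_mul hf hg]
  have : ∀ i : Fin n, dirDeriv (eb n i, (0 : ℝ)) (fun q => dirDeriv (eb n i, 0) f q * g q
        + f q * dirDeriv (eb n i, 0) g q) p
      = f p * dirDeriv (eb n i, 0) (dirDeriv (eb n i, 0) g) p
        + dirDeriv (eb n i, 0) (dirDeriv (eb n i, 0) f) p * g p
        + 2 * (dirDeriv (eb n i, 0) f p * dirDeriv (eb n i, 0) g p) := by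
    intro i
    rw [dirDeriv_add ((hf.dirDeriv _).mul hg) (hf.mul (hg.dirDeriv _)),
      dirDeriv_mul (hf.dirDeriv _) hg, dirDeriv_mul hf (hg.dirDeriv _)]
    ring
  simp only [this, Finset.sum_add_distrib, ← Finset.mul_sum, ← Finset.sum_mul]
  ring

end HeatOp

/-! ### The half-space cylinder and integrability of weighted bounded functions -/

section Cylinder

variable {n : ℕ}

/-- The last coordinate as a continuous linear functional. -/
def lastProj (n : ℕ) (hn : 2 ≤ n) : En n →L[ℝ] ℝ := EuclideanSpace.proj (lastIdx n hn)

/-- The space-time cylinder over the open half space. -/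
def halfCyl (n : ℕ) (hn : 2 ≤ n) (T : ℝ) : Set (En n × ℝ) := openHalf n hn ×ˢ Ioo 0 T

lemma continuous_xlast (hn : 2 ≤ n) : Continuous (xlast n hn) :=
  (lastProj n hn).continuous

lemma isOpen_openHalf (hn : 2 ≤ n) : IsOpen (openHalf n hn) :=
  isOpen_lt continuous_const (continuous_xlast hn)

lemma isOpen_halfCyl (hn : 2 ≤ n) (T : ℝ) : IsOpen (halfCyl n hn T) :=
  (isOpen_openHalf hn).prod isOpen_Ioo

lemma volume_restrict_halfCyl (hn : 2 ≤ n) (T : ℝ) :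
    (volume : Measure (En n × ℝ)).restrict (halfCyl n hn T)
      = (volume.restrict (openHalf n hn)).prod (volume.restrict (Ioo 0 T)) :=
  (Measure.prod_restrict _ _).symm

variable {hn : 2 ≤ n} {T γ C : ℝ} {w : En n × ℝ → ℝ}

lemma lintegral_rpow_neg_lt_top (hγ1 : γ < 1) (hT : 0 < T) (C : ℝ) :
    ∫⁻ t in Ioo (0 : ℝ) T, ENNReal.ofReal (C * t ^ (-γ)) < ⊤ := by
  have h := (intervalIntegral.intervalIntegrable_rpow' (a := 0) (b := T)
    (show -1 < -γ by linarith)).const_mul C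
  rw [intervalIntegrable_iff_integrableOn_Ioo_of_le hT.le] at h
  refine lt_of_le_of_lt (lintegral_mono fun t => ?_) h.hasFiniteIntegral
  rw [Real.enorm_eq_ofReal_abs]
  exact ENNReal.ofReal_le_ofReal (le_abs_self _)

lemma integrableOn_mul_of_lintegral_slice_le (hγ1 : γ < 1) (hT : 0 < T)
    (hw : Measurable w) (hb : ∀ p ∈ halfCyl n hn T, |w p| ≤ C * p.2 ^ (-γ))
    {g : En n × ℝ → ℝ} (hg : Measurable g) {B : ℝ≥0∞} (hB : B ≠ ⊤)
    (hgB : ∀ t, ∫⁻ x, ‖g (x, t)‖ₑ ≤ B) :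
    IntegrableOn (fun p => w p * g p) (halfCyl n hn T) := by
  refine ⟨(hw.mul hg).aestronglyMeasurable, ?_⟩
  have hD := (isOpen_halfCyl hn T).measurableSet
  have hγ : Measurable fun t : ℝ => ENNReal.ofReal (C * t ^ (-γ)) := by fun_prop
  have h1 : ∫⁻ p in halfCyl n hn T, ‖w p * g p‖ₑ
      ≤ ∫⁻ p in halfCyl n hn T, ENNReal.ofReal (C * p.2 ^ (-γ)) * ‖g p‖ₑ := by
    refine setLIntegral_mono' hD fun p hp => ?_
    rw [enorm_mul, Real.enorm_eq_ofReal_abs (w p)]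
    gcongr
    exact hb p hp
  refine lt_of_le_of_lt h1 ?_
  rw [volume_restrict_halfCyl, lintegral_prod_symm _ (by fun_prop)]
  have h2 : ∀ t : ℝ, ∫⁻ x in openHalf n hn, ENNReal.ofReal (C * t ^ (-γ)) * ‖g (x, t)‖ₑ
      ≤ ENNReal.ofReal (C * t ^ (-γ)) * B := by
    intro t
    rw [lintegral_const_mul _ (by fun_prop)]
    gcongr
    exact (setLIntegral_le_lintegral _ _).trans (hgB t)
  refine lt_of_le_of_lt (lintegral_mono h2) ?_
  rw [lintegral_mul_const _ hγ]
  exact ENNReal.mul_lt_top (lintegral_rpow_neg_lt_top hγ1 hT C) hB.lt_top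

lemma exists_lintegral_slice_le {g : En n × ℝ → ℝ} (hgc : Continuous g)
    (hgs : HasCompactSupport g) :
    ∃ B : ℝ≥0∞, B ≠ ⊤ ∧ ∀ t, ∫⁻ x, ‖g (x, t)‖ₑ ≤ B := by
  obtain ⟨M, hM⟩ := hgs.exists_bound_of_continuous hgc
  have hK : IsCompact (Prod.fst '' tsupport g) := hgs.isCompact.image continuous_fst
  refine ⟨ENNReal.ofReal M * volume (Prod.fst '' tsupport g),
    ENNReal.mul_ne_top ENNReal.ofReal_ne_top hK.measure_lt_top.ne, fun t => ?_⟩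
  rw [← lintegral_indicator_const hK.measurableSet]
  refine lintegral_mono fun x => ?_
  by_cases hx : (x, t) ∈ tsupport g
  · rw [indicator_of_mem (mem_image_of_mem Prod.fst hx), ← ofReal_norm]
    exact ENNReal.ofReal_le_ofReal (hM _)
  · simp [image_eq_zero_of_notMem_tsupport hx]

lemma integrableOn_mul_of_hasCompactSupport (hγ1 : γ < 1) (hT : 0 < T)
    (hw : Measurable w) (hb : ∀ p ∈ halfCyl n hn T, |w p| ≤ C * p.2 ^ (-γ))
    {g : En n × ℝ → ℝ} (hgc : Continuous g) (hgs : HasCompactSupport g) :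
    IntegrableOn (fun p => w p * g p) (halfCyl n hn T) := by
  obtain ⟨B, hB, h⟩ := exists_lintegral_slice_le hgc hgs
  exact integrableOn_mul_of_lintegral_slice_le hγ1 hT hw hb hgc.measurable hB h

end Cylinder

/-! ### Extending the weak formulation to test functions vanishing on the boundary -/

section Boundary

/-- A smooth step equal to `0` on `(-∞, 1]` and to `1` on `[2, ∞)`. -/
def smoothStep (s : ℝ) : ℝ := Real.smoothTransition (s - 1)

lemma contDiff_smoothStep : ContDiff ℝ ∞ smoothStep :=
  Real.smoothTransition.contDiff.comp (contDiff_id.sub contDiff_const)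

lemma smoothStep_of_le {s : ℝ} (hs : s ≤ 1) : smoothStep s = 0 :=
  Real.smoothTransition.zero_of_nonpos (by linarith)

lemma smoothStep_of_ge {s : ℝ} (hs : 2 ≤ s) : smoothStep s = 1 :=
  Real.smoothTransition.one_of_one_le (by linarith)

lemma abs_smoothStep_le (s : ℝ) : |smoothStep s| ≤ 1 := by
  rw [smoothStep, abs_of_nonneg (Real.smoothTransition.nonneg _)]
  exact Real.smoothTransition.le_one _

lemma contDiff_deriv_of_contDiff {h : ℝ → ℝ} (hh : ContDiff ℝ ∞ h) : ContDiff ℝ ∞ (deriv h) :=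
  (contDiff_infty_iff_deriv.1 hh).2

lemma deriv_smoothStep_eq_zero {s : ℝ} (hs : s ∉ Icc (1 : ℝ) 2) : deriv smoothStep s = 0 := by
  rw [mem_Icc, not_and_or, not_le, not_le] at hs
  rcases hs with hs | hs
  · have : smoothStep =ᶠ[𝓝 s] fun _ => 0 := by
      filter_upwards [Iio_mem_nhds hs] with r hr using smoothStep_of_le (le_of_lt hr)
    rw [this.deriv_eq, deriv_const]
  · have : smoothStep =ᶠ[𝓝 s] fun _ => 1 := by
      filter_upwards [Ioi_mem_nhds hs] with r hr using smoothStep_of_ge (le_of_lt hr)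
    rw [this.deriv_eq, deriv_const]

lemma hasCompactSupport_deriv_smoothStep : HasCompactSupport (deriv smoothStep) :=
  HasCompactSupport.intro isCompact_Icc fun _ hs => deriv_smoothStep_eq_zero hs

lemma deriv_deriv_smoothStep_eq_zero {s : ℝ} (hs : s ∉ Icc (1 : ℝ) 2) :
    deriv (deriv smoothStep) s = 0 := by
  have : deriv smoothStep =ᶠ[𝓝 s] fun _ => 0 := by
    filter_upwards [isClosed_Icc.isOpen_compl.mem_nhds hs] with r hr
      using deriv_smoothStep_eq_zero hr
  rw [this.deriv_eq, deriv_const]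

lemma exists_bound_deriv_smoothStep :
    ∃ K : ℝ, 0 ≤ K ∧ (∀ s, |deriv smoothStep s| ≤ K) ∧ ∀ s, |deriv (deriv smoothStep) s| ≤ K := by
  have h1 := contDiff_deriv_of_contDiff contDiff_smoothStep
  obtain ⟨K₁, hK₁⟩ := hasCompactSupport_deriv_smoothStep.exists_bound_of_continuous h1.continuous
  obtain ⟨K₂, hK₂⟩ := hasCompactSupport_deriv_smoothStep.deriv.exists_bound_of_continuous
    (contDiff_deriv_of_contDiff h1).continuous
  exact ⟨max K₁ K₂, (abs_nonneg _).trans ((hK₁ 0).trans (le_max_left _ _)),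
    fun s => (hK₁ s).trans (le_max_left _ _), fun s => (hK₂ s).trans (le_max_right _ _)⟩

variable {n : ℕ}

lemma lastProj_eb (hn : 2 ≤ n) (i : Fin n) :
    lastProj n hn (eb n i) = if i = lastIdx n hn then 1 else 0 := by
  simp [lastProj, eb, eq_comm]

lemma norm_eb (i : Fin n) : ‖eb n i‖ = 1 := by simp [eb]

/-- The profile `h` applied to the rescaled last coordinate. -/
def layerFun (hn : 2 ≤ n) (ε : ℝ) (h : ℝ → ℝ) (p : En n × ℝ) : ℝ := h (xlast n hn p.1 / ε)

variable {hn : 2 ≤ n}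

lemma contDiff_layerFun {h : ℝ → ℝ} (hh : ContDiff ℝ ∞ h) (ε : ℝ) :
    ContDiff ℝ ∞ (layerFun hn ε h) :=
  hh.comp (((lastProj n hn).contDiff.comp contDiff_fst).div_const ε)

lemma dirDeriv_layerFun {h : ℝ → ℝ} (hh : ContDiff ℝ ∞ h) (ε : ℝ) (u : En n × ℝ) (p : En n × ℝ) :
    dirDeriv u (layerFun hn ε h) p = (xlast n hn u.1 / ε) * layerFun hn ε (deriv h) p := by
  have h1 : HasFDerivAt (fun q : En n × ℝ => ε⁻¹ * lastProj n hn q.1)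
      (ε⁻¹ • ((lastProj n hn).comp (ContinuousLinearMap.fst ℝ (En n) ℝ))) p :=
    (((lastProj n hn).comp (ContinuousLinearMap.fst ℝ (En n) ℝ)).hasFDerivAt).const_mul ε⁻¹
  have h2 : HasDerivAt h (deriv h (ε⁻¹ * lastProj n hn p.1)) (ε⁻¹ * lastProj n hn p.1) :=
    ((hh.differentiable (by simp)).differentiableAt).hasDerivAt
  have h3 := h2.comp_hasFDerivAt p h1
  have h4 : layerFun hn ε h = h ∘ fun q : En n × ℝ => ε⁻¹ * lastProj n hn q.1 := by
    funext q
    simp [layerFun, div_eq_inv_mul, lastProj, xlast]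
  rw [dirDeriv, h4, h3.fderiv]
  simp [layerFun, lastProj, xlast, div_eq_inv_mul]
  ring

lemma heatOp_layerFun {h : ℝ → ℝ} (hh : ContDiff ℝ ∞ h) (ε : ℝ) (p : En n × ℝ) :
    heatOp (layerFun hn ε h) p = ε⁻¹ ^ 2 * layerFun hn ε (deriv (deriv h)) p := by
  have hx : ∀ i, xlast n hn (eb n i) = if i = lastIdx n hn then 1 else 0 := lastProj_eb hn
  have h1 : ∀ i : Fin n, spDeriv i (layerFun hn ε h)
      = layerFun hn ε fun s => (xlast n hn (eb n i) / ε) * deriv h s :=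
    fun i => funext fun q => dirDeriv_layerFun hh ε _ q
  have h2 := contDiff_deriv_of_contDiff hh
  simp only [heatOp, h1]
  rw [dirDeriv_layerFun hh]
  simp only [spDeriv, dirDeriv_layerFun (contDiff_const.mul h2)]
  have h3 : ∀ c : ℝ, deriv (fun s => c * deriv h s) = fun s => c * deriv (deriv h) s :=
    fun c => funext fun s => deriv_const_mul_field c
  simp only [h3, hx, layerFun]
  have h0 : xlast n hn 0 = 0 := (lastProj n hn).map_zero
  rw [Finset.sum_eq_single (lastIdx n hn) (by intro b _ hb; simp [hb]) (by simp), h0]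
  simp
  ring

lemma sum_spDeriv_layerFun {h : ℝ → ℝ} (hh : ContDiff ℝ ∞ h) (ε : ℝ) (Φ : En n × ℝ → ℝ)
    (p : En n × ℝ) :
    ∑ i, spDeriv i (layerFun hn ε h) p * spDeriv i Φ p
      = ε⁻¹ * layerFun hn ε (deriv h) p * spDeriv (lastIdx n hn) Φ p := by
  have hx : ∀ i, xlast n hn (eb n i) = if i = lastIdx n hn then 1 else 0 := lastProj_eb hn
  simp only [spDeriv, dirDeriv_layerFun hh, hx]
  rw [Finset.sum_eq_single (lastIdx n hn) (by intro b _ hb; simp [hb]) (by simp)]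
  simp

end Boundary

section BoundaryLayer

variable {n : ℕ} {hn : 2 ≤ n} {T γ C : ℝ} {w : En n × ℝ → ℝ}

/-- Scaling of the last space coordinate by `ε`. -/
def scaleLast (hn : 2 ≤ n) (ε : ℝ) : En n × ℝ →ₗ[ℝ] En n × ℝ :=
  LinearMap.transvection
    ((ε - 1) • ((lastProj n hn).comp (ContinuousLinearMap.fst ℝ (En n) ℝ)).toLinearMap)
    (eb n (lastIdx n hn), 0)

lemma scaleLast_apply (ε : ℝ) (p : En n × ℝ) :
    scaleLast hn ε p = (p.1 + ((ε - 1) * xlast n hn p.1) • eb n (lastIdx n hn), p.2) := by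
  rw [scaleLast, LinearMap.transvection.apply]
  ext <;> simp [lastProj, xlast]

lemma xlast_add_smul (x : En n) (c : ℝ) :
    xlast n hn (x + c • eb n (lastIdx n hn)) = xlast n hn x + c := by
  simp [xlast, eb]

lemma xlast_scaleLast (ε : ℝ) (p : En n × ℝ) :
    xlast n hn (scaleLast hn ε p).1 = ε * xlast n hn p.1 := by
  rw [scaleLast_apply, xlast_add_smul]
  ring

lemma scaleLast_mem_halfCyl {ε : ℝ} (hε : 0 < ε) (p : En n × ℝ) :
    scaleLast hn ε p ∈ halfCyl n hn T ↔ p ∈ halfCyl n hn T := by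
  simp only [halfCyl, mem_prod, openHalf, mem_ofPred_eq, xlast_scaleLast, mul_pos_iff_of_pos_left hε]
  simp [scaleLast_apply]

lemma det_scaleLast (ε : ℝ) : LinearMap.det (scaleLast hn ε) = ε := by
  rw [scaleLast, LinearMap.transvection.det]
  simp [lastProj_eb]

instance isAddHaarMeasure_volume_prod :
    (volume : Measure (En n × ℝ)).IsAddHaarMeasure :=
  Measure.prod.instIsAddHaarMeasure (volume : Measure (En n)) (volume : Measure ℝ)

lemma setIntegral_halfCyl_eq_scaleLast {ε : ℝ} (hε : 0 < ε) {F : En n × ℝ → ℝ} (hF : Measurable F) :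
    ∫ p in halfCyl n hn T, F p = ε * ∫ p in halfCyl n hn T, F (scaleLast hn ε p) := by
  have hD := (isOpen_halfCyl hn T).measurableSet
  have hA : Measurable (scaleLast hn ε) :=
    (LinearMap.continuous_of_finiteDimensional _).measurable
  have h1 := Measure.map_linearMap_addHaar_eq_smul_addHaar (volume : Measure (En n × ℝ))
    (f := scaleLast hn ε) (by rw [det_scaleLast]; exact hε.ne')
  have h2 := integral_map (μ := (volume : Measure (En n × ℝ))) hA.aemeasurable
    (f := (halfCyl n hn T).indicator F) (hF.indicator hD).aestronglyMeasurable
  rw [h1, det_scaleLast, integral_smul_measure, integral_indicator hD] at h2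
  have h3 : (fun p => (halfCyl n hn T).indicator F (scaleLast hn ε p))
      = (halfCyl n hn T).indicator fun p => F (scaleLast hn ε p) := by
    funext p
    by_cases hp : p ∈ halfCyl n hn T
    · rw [indicator_of_mem hp, indicator_of_mem ((scaleLast_mem_halfCyl hε p).2 hp)]
    · rw [indicator_of_notMem hp, indicator_of_notMem (mt (scaleLast_mem_halfCyl hε p).1 hp)]
  rw [h3, integral_indicator hD] at h2
  rw [← h2, ENNReal.toReal_ofReal (abs_nonneg _), abs_of_pos (inv_pos.2 hε), smul_eq_mul]
  field_simp

lemma exists_abs_le_mul_xlast {Φ : En n × ℝ → ℝ} (hΦ : ContDiff ℝ ∞ Φ) (hs : HasCompactSupport Φ)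
    (h0 : ∀ p, xlast n hn p.1 = 0 → Φ p = 0) :
    ∃ M : ℝ, 0 ≤ M ∧ ∀ p, |Φ p| ≤ M * |xlast n hn p.1| := by
  obtain ⟨M, hM⟩ := hΦ.lipschitzWith_of_hasCompactSupport hs (by simp)
  refine ⟨M, M.2, fun p => ?_⟩
  have h1 := hM.dist_le_mul p (scaleLast hn 0 p)
  rw [h0 (scaleLast hn 0 p) (by rw [xlast_scaleLast, zero_mul]), dist_zero_right,
    Real.norm_eq_abs, dist_eq_norm] at h1
  have h2 : p - scaleLast hn 0 p = ((xlast n hn p.1) • eb n (lastIdx n hn), 0) := by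
    rw [scaleLast_apply]
    ext <;> simp
  rwa [h2, Prod.norm_mk, norm_smul, norm_eb, norm_zero, mul_one, Real.norm_eq_abs,
    max_eq_left (abs_nonneg _)] at h1

lemma tendsto_integral_boundaryLayer (hγ1 : γ < 1) (hT : 0 < T) (hw : Measurable w)
    (hC : 0 ≤ C) (hb : ∀ p ∈ halfCyl n hn T, |w p| ≤ C * p.2 ^ (-γ))
    (hlim : ∀ p ∈ halfCyl n hn T, Tendsto (fun ε => w (scaleLast hn ε p)) (𝓝[>] 0) (𝓝 0))
    {Φ : En n × ℝ → ℝ} (hΦ : ContDiff ℝ ∞ Φ) (hs : HasCompactSupport Φ)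
    (h0 : ∀ p, xlast n hn p.1 = 0 → Φ p = 0) :
    Tendsto (fun ε => ∫ p in halfCyl n hn T, w p *
      (ε⁻¹ ^ 2 * layerFun hn ε (deriv (deriv smoothStep)) p * Φ p
        + 2 * (ε⁻¹ * layerFun hn ε (deriv smoothStep) p * spDeriv (lastIdx n hn) Φ p)))
      (𝓝[>] 0) (𝓝 0) := by
  obtain ⟨M, hM0, hM⟩ := exists_abs_le_mul_xlast hΦ hs h0
  obtain ⟨K, hK0, hK1, hK2⟩ := exists_bound_deriv_smoothStep
  have hdΦ : ContDiff ℝ ∞ (spDeriv (lastIdx n hn) Φ) := hΦ.dirDeriv _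
  obtain ⟨N, hN⟩ := (hs.dirDeriv (eb n (lastIdx n hn), (0 : ℝ))).exists_bound_of_continuous
    hdΦ.continuous
  obtain ⟨R, hR⟩ := (hs.isCompact.image continuous_fst).isBounded.exists_norm_le
  have hN0 : 0 ≤ N := (norm_nonneg _).trans (hN 0)
  have hη1 := contDiff_deriv_of_contDiff contDiff_smoothStep
  have hη2 := contDiff_deriv_of_contDiff hη1
  set G : ℝ → En n × ℝ → ℝ := fun ε p =>
    ε⁻¹ * deriv (deriv smoothStep) (xlast n hn p.1) * Φ (scaleLast hn ε p)
      + 2 * (deriv smoothStep (xlast n hn p.1) * spDeriv (lastIdx n hn) Φ (scaleLast hn ε p)) with hG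
  set L := 2 * K * M + 2 * (K * N) with hL
  set χ : En n × ℝ → ℝ := fun p => (closedBall (0 : En n) (R + 2)).indicator (fun _ => L) p.1 with hχ
  have hL0 : 0 ≤ L := by positivity
  have hχ0 : ∀ p, 0 ≤ χ p := fun p => indicator_nonneg (fun _ _ => hL0) _
  have hA : ∀ ε : ℝ, Continuous (scaleLast hn ε) := fun ε =>
    LinearMap.continuous_of_finiteDimensional _
  have hxl : Continuous fun p : En n × ℝ => xlast n hn p.1 :=
    (continuous_xlast hn).comp continuous_fst
  have hGb : ∀ ε ∈ Ioo (0 : ℝ) 1, ∀ p, |G ε p| ≤ χ p := by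
    intro ε hε p
    by_cases h1 : xlast n hn p.1 ∈ Icc (1 : ℝ) 2
    · by_cases h2 : scaleLast hn ε p ∈ tsupport Φ
      · have h3 : p.1 ∈ closedBall (0 : En n) (R + 2) := by
          have h4 := hR _ (mem_image_of_mem Prod.fst h2)
          have h5 : p.1 = (scaleLast hn ε p).1
              + ((1 - ε) * xlast n hn p.1) • eb n (lastIdx n hn) := by
            rw [scaleLast_apply]
            module
          rw [mem_closedBall_zero_iff, h5]
          refine (norm_add_le _ _).trans (add_le_add h4 ?_)
          rw [norm_smul, norm_eb, mul_one, Real.norm_eq_abs, abs_of_nonneg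
            (mul_nonneg (by linarith [hε.2]) (by linarith [h1.1]))]
          nlinarith [h1.1, h1.2, hε.1, hε.2]
        simp only [hχ, indicator_of_mem h3, hG]
        refine (abs_add_le _ _).trans (add_le_add ?_ ?_)
        · rw [abs_mul, abs_mul, abs_inv, abs_of_pos hε.1]
          have h6 := hM (scaleLast hn ε p)
          rw [xlast_scaleLast, abs_mul, abs_of_pos hε.1,
            abs_of_nonneg (by linarith [h1.1] : 0 ≤ xlast n hn p.1)] at h6
          calc ε⁻¹ * |deriv (deriv smoothStep) (xlast n hn p.1)| * |Φ (scaleLast hn ε p)|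
              ≤ ε⁻¹ * K * (M * (ε * 2)) := by
                have := hε.1.le
                gcongr
                · exact hK2 _
                · refine h6.trans ?_
                  gcongr
                  exact h1.2
            _ = 2 * K * M := by
                have := hε.1.ne'
                field_simp
        · rw [abs_mul, abs_mul, abs_two]
          gcongr
          · exact hK1 _
          · exact hN _
      · have h3 : spDeriv (lastIdx n hn) Φ (scaleLast hn ε p) = 0 :=
          image_eq_zero_of_notMem_tsupport fun h => h2 (tsupport_dirDeriv_subset _ _ h)
        simp only [hG, image_eq_zero_of_notMem_tsupport h2, h3]
        simpa using hχ0 p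
    · simp only [hG, deriv_smoothStep_eq_zero h1, deriv_deriv_smoothStep_eq_zero h1]
      simpa using hχ0 p
  have hχm : Measurable χ :=
    (measurable_const.indicator measurableSet_closedBall).comp measurable_fst
  have hχi : IntegrableOn (fun p : En n × ℝ => C * p.2 ^ (-γ) * χ p) (halfCyl n hn T) := by
    refine integrableOn_mul_of_lintegral_slice_le (w := fun p => C * p.2 ^ (-γ)) (C := C) hγ1 hT
      (by fun_prop) (fun p hp => ?_) hχm
      (B := ENNReal.ofReal L * volume (closedBall (0 : En n) (R + 2)))
      (ENNReal.mul_ne_top ENNReal.ofReal_ne_top measure_closedBall_lt_top.ne) (fun t => ?_)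
    · rw [abs_of_nonneg (mul_nonneg hC (Real.rpow_nonneg hp.2.1.le _))]
    · rw [← lintegral_indicator_const measurableSet_closedBall]
      refine lintegral_mono fun x => ?_
      rw [← ofReal_norm, Real.norm_eq_abs, abs_of_nonneg (hχ0 _)]
      simp only [hχ]
      by_cases hx : x ∈ closedBall (0 : En n) (R + 2) <;> simp [hx]
  have hev : ∀ᶠ ε : ℝ in 𝓝[>] 0, ε ∈ Ioo (0 : ℝ) 1 := Ioo_mem_nhdsGT one_pos
  have hlim' : Tendsto (fun ε => ∫ p in halfCyl n hn T, w (scaleLast hn ε p) * G ε p)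
      (𝓝[>] 0) (𝓝 (∫ _ in halfCyl n hn T, (0 : ℝ))) := by
    refine tendsto_integral_filter_of_dominated_convergence
      (fun p : En n × ℝ => C * p.2 ^ (-γ) * χ p) ?_ ?_ hχi ?_
    · refine .of_forall fun ε => Measurable.aestronglyMeasurable ?_
      refine (hw.comp (hA ε).measurable).mul (Continuous.measurable ?_)
      exact ((continuous_const.mul (hη2.continuous.comp hxl)).mul
        (hΦ.continuous.comp (hA ε))).add (continuous_const.mul ((hη1.continuous.comp hxl).mul
          (hdΦ.continuous.comp (hA ε))))
    · filter_upwards [hev] with ε hε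
      refine (ae_restrict_mem (isOpen_halfCyl hn T).measurableSet).mono fun p hp => ?_
      rw [norm_mul, Real.norm_eq_abs, Real.norm_eq_abs]
      have h1 := hb _ ((scaleLast_mem_halfCyl hε.1 p).2 hp)
      have h2 : (scaleLast hn ε p).2 = p.2 := by rw [scaleLast_apply]
      rw [h2] at h1
      exact mul_le_mul h1 (hGb ε hε p) (abs_nonneg _) ((abs_nonneg _).trans h1)
    · refine (ae_restrict_mem (isOpen_halfCyl hn T).measurableSet).mono fun p hp => ?_
      have h1 : Tendsto (fun ε => |w (scaleLast hn ε p)| * χ p) (𝓝[>] 0) (𝓝 0) := by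
        simpa using (hlim p hp).abs.mul_const (χ p)
      refine squeeze_zero_norm' ?_ h1
      filter_upwards [hev] with ε hε
      rw [norm_mul, Real.norm_eq_abs, Real.norm_eq_abs]
      exact mul_le_mul_of_nonneg_left (hGb ε hε p) (abs_nonneg _)
  rw [integral_zero] at hlim'
  refine hlim'.congr' ?_
  filter_upwards [hev] with ε hε
  have hε0 := hε.1.ne'
  have hlay : ∀ h : ℝ → ℝ, Continuous h → Continuous (layerFun hn ε h) := fun h hh =>
    hh.comp (hxl.div_const ε)
  symm
  rw [setIntegral_halfCyl_eq_scaleLast hε.1, ← integral_const_mul]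
  · refine integral_congr_ae (.of_forall fun p => ?_)
    simp only [hG, layerFun, xlast_scaleLast, mul_div_cancel_left₀ _ hε0]
    field_simp
  · refine hw.mul (Continuous.measurable ?_)
    exact ((continuous_const.mul (hlay _ hη2.continuous)).mul hΦ.continuous).add
      (continuous_const.mul ((continuous_const.mul (hlay _ hη1.continuous)).mul hdΦ.continuous))

/-- The weak formulation extends from test functions supported in the open half space to test
functions vanishing on the boundary hyperplane. -/
lemma integral_mul_heatOp_eq_zero_of_vanishing (hγ1 : γ < 1) (hT : 0 < T) (hw : Measurable w)
    (hC : 0 ≤ C) (hb : ∀ p ∈ halfCyl n hn T, |w p| ≤ C * p.2 ^ (-γ))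
    (hlim : ∀ p ∈ halfCyl n hn T, Tendsto (fun ε => w (scaleLast hn ε p)) (𝓝[>] 0) (𝓝 0))
    (hweak : ∀ φ : En n × ℝ → ℝ, ContDiff ℝ ∞ φ → HasCompactSupport φ →
      tsupport φ ⊆ openHalf n hn ×ˢ Iio T → ∫ p in halfCyl n hn T, w p * heatOp φ p = 0)
    {Φ : En n × ℝ → ℝ} (hΦ : ContDiff ℝ ∞ Φ) (hs : HasCompactSupport Φ)
    (hsT : ∀ p ∈ tsupport Φ, p.2 < T)
    (h0 : ∀ p, xlast n hn p.1 = 0 → Φ p = 0) :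
    ∫ p in halfCyl n hn T, w p * heatOp Φ p = 0 := by
  have hlayer := tendsto_integral_boundaryLayer hγ1 hT hw hC hb hlim hΦ hs h0
  have hη := contDiff_smoothStep
  have hη1 := contDiff_deriv_of_contDiff hη
  have hη2 := contDiff_deriv_of_contDiff hη1
  have hcut : ∀ ε, ContDiff ℝ ∞ (layerFun hn ε smoothStep) := fun ε => contDiff_layerFun hη ε
  have hdΦ : ContDiff ℝ ∞ (spDeriv (lastIdx n hn) Φ) := hΦ.dirDeriv _
  have hxl : Continuous fun p : En n × ℝ => xlast n hn p.1 :=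
    (continuous_xlast hn).comp continuous_fst
  have hint := integrableOn_mul_of_hasCompactSupport hγ1 hT hw hb hΦ.heatOp.continuous hs.heatOp
  have hmain : Tendsto (fun ε => ∫ p in halfCyl n hn T,
      w p * heatOp Φ p * layerFun hn ε smoothStep p) (𝓝[>] 0)
      (𝓝 (∫ p in halfCyl n hn T, w p * heatOp Φ p)) := by
    refine tendsto_integral_filter_of_dominated_convergence (fun p => |w p * heatOp Φ p|)
      (.of_forall fun ε => ?_) (.of_forall fun ε => .of_forall fun p => ?_) hint.abs ?_
    · exact ((hw.mul hΦ.heatOp.continuous.measurable).mul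
        (hcut ε).continuous.measurable).aestronglyMeasurable
    · rw [norm_mul, Real.norm_eq_abs, Real.norm_eq_abs]
      exact mul_le_of_le_one_right (abs_nonneg _) (abs_smoothStep_le _)
    · refine (ae_restrict_mem (isOpen_halfCyl hn T).measurableSet).mono fun p hp => ?_
      have hp1 : 0 < xlast n hn p.1 := hp.1
      refine tendsto_const_nhds.congr' ?_
      filter_upwards [Ioo_mem_nhdsGT (half_pos hp1)] with ε hε
      rw [layerFun, smoothStep_of_ge, mul_one]
      rw [le_div_iff₀ hε.1]
      linarith [hε.2]
  have hsum := hmain.add hlayer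
  rw [add_zero] at hsum
  refine tendsto_nhds_unique hsum (tendsto_const_nhds.congr' ?_)
  filter_upwards [self_mem_nhdsWithin] with ε hε
  have hε : 0 < ε := hε
  have hprod := (hcut ε).mul hΦ
  have hsupp : tsupport (fun p => layerFun hn ε smoothStep p * Φ p) ⊆ tsupport Φ :=
    tsupport_mul_subset_right
  have hlow : tsupport (fun p => layerFun hn ε smoothStep p * Φ p)
      ⊆ {p | ε ≤ xlast n hn p.1} := by
    refine closure_minimal (fun p hp => ?_) (isClosed_le continuous_const hxl)
    by_contra h
    refine hp ?_
    rw [mem_ofPred_eq, not_le] at h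
    simp only [layerFun]
    rw [smoothStep_of_le (by rw [div_le_one hε]; exact h.le), zero_mul]
  have hz := hweak _ hprod (hs.mul_left) fun p hp =>
    ⟨lt_of_lt_of_le hε (hlow hp), hsT p (hsupp hp)⟩
  rw [← hz, ← integral_add]
  · refine integral_congr_ae (.of_forall fun p => ?_)
    simp only [heatOp_mul (hcut ε) hΦ, heatOp_layerFun hη, sum_spDeriv_layerFun hη]
    ring
  · have := integrableOn_mul_of_hasCompactSupport hγ1 hT hw hb
      (hΦ.heatOp.continuous.mul (hcut ε).continuous) (hs.heatOp.mul_right)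
    refine this.congr (.of_forall fun p => ?_)
    simp only [Pi.mul_apply]
    ring
  · refine integrableOn_mul_of_hasCompactSupport hγ1 hT hw hb
      (((continuous_const.mul (contDiff_layerFun hη2 ε).continuous).mul hΦ.continuous).add
      (continuous_const.mul ((continuous_const.mul (contDiff_layerFun hη1 ε).continuous).mul
        hdΦ.continuous))) ?_
    exact HasCompactSupport.add hs.mul_left (hs.dirDeriv _).mul_left.mul_left

end BoundaryLayer

/-! ### Gaussian averages solve the backward heat equation -/

section Gaussian

variable {n : ℕ}

/-- The unnormalised standard Gaussian measure on `ℝⁿ`. -/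
def gaussMeasure (n : ℕ) : Measure (En n) :=
  volume.withDensity fun z => ENNReal.ofReal (Real.exp (-‖z‖ ^ 2 / 2))

lemma integrable_gaussWeight {b : ℝ} (hb : 0 < b) :
    Integrable fun z : En n => Real.exp (-b * ‖z‖ ^ 2) := by
  have h := (GaussianFourier.integrable_cexp_neg_mul_sq_norm_add (V := En n) (b := (b : ℂ))
    (by simpa using hb) 0 0).re
  refine h.congr (.of_forall fun z => ?_)
  simp only [zero_mul, add_zero]
  rw [← Complex.exp_ofReal_re]
  push_cast
  rfl

lemma integrable_gaussWeight_half : Integrable fun z : En n => Real.exp (-‖z‖ ^ 2 / 2) := by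
  refine (integrable_gaussWeight (n := n) (b := 1 / 2) (by norm_num)).congr (.of_forall fun z => ?_)
  dsimp only
  congr 1
  ring

instance isFiniteMeasure_gaussMeasure : IsFiniteMeasure (gaussMeasure n) :=
  isFiniteMeasure_withDensity_ofReal integrable_gaussWeight_half.2

lemma integral_gaussMeasure (f : En n → ℝ) :
    ∫ z, f z ∂gaussMeasure n = ∫ z, Real.exp (-‖z‖ ^ 2 / 2) * f z := by
  rw [gaussMeasure, integral_withDensity_eq_integral_toReal_smul (by fun_prop)
    (.of_forall fun _ => ENNReal.ofReal_lt_top)]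
  refine integral_congr_ae (.of_forall fun z => ?_)
  simp only [ENNReal.toReal_ofReal (Real.exp_pos _).le, smul_eq_mul]

lemma integrable_gaussMeasure_iff (f : En n → ℝ) :
    Integrable f (gaussMeasure n) ↔ Integrable fun z => Real.exp (-‖z‖ ^ 2 / 2) * f z := by
  rw [gaussMeasure, integrable_withDensity_iff_integrable_smul' (by fun_prop)
    (.of_forall fun _ => ENNReal.ofReal_lt_top)]
  simp only [ENNReal.toReal_ofReal (Real.exp_pos _).le, smul_eq_mul]

lemma integrable_norm_gaussMeasure : Integrable (fun z : En n => ‖z‖) (gaussMeasure n) := by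
  rw [integrable_gaussMeasure_iff]
  refine ((integrable_gaussWeight (n := n) (b := 1 / 4) (by norm_num)).const_mul 2).mono'
    (by fun_prop) (.of_forall fun z => ?_)
  rw [norm_mul, norm_norm, Real.norm_eq_abs, abs_of_pos (Real.exp_pos _)]
  have h1 : ‖z‖ ≤ 2 * Real.exp (‖z‖ ^ 2 / 4) := by
    have := Real.add_one_le_exp (‖z‖ ^ 2 / 4)
    nlinarith [sq_nonneg (‖z‖ - 2)]
  calc Real.exp (-‖z‖ ^ 2 / 2) * ‖z‖
      ≤ Real.exp (-‖z‖ ^ 2 / 2) * (2 * Real.exp (‖z‖ ^ 2 / 4)) := by gcongr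
    _ = 2 * Real.exp (-(1 / 4) * ‖z‖ ^ 2) := by
      rw [mul_left_comm, ← Real.exp_add]
      congr 2
      ring

lemma integral_one_gaussMeasure_pos : 0 < ∫ _, (1 : ℝ) ∂gaussMeasure n := by
  rw [integral_gaussMeasure]
  simp only [mul_one]
  exact integral_exp_pos integrable_gaussWeight_half

lemma integral_gaussMeasure_comp_isometry (R : En n ≃ₗᵢ[ℝ] En n) (f : En n → ℝ) :
    ∫ z, f (R z) ∂gaussMeasure n = ∫ z, f z ∂gaussMeasure n := by
  rw [integral_gaussMeasure, integral_gaussMeasure]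
  have := R.measurePreserving.integral_comp R.toHomeomorph.measurableEmbedding
    fun z => Real.exp (-‖z‖ ^ 2 / 2) * f z
  rw [← this]
  simp

lemma fderiv_gaussWeight (z u : En n) :
    fderiv ℝ (fun z : En n => Real.exp (-‖z‖ ^ 2 / 2)) z u
      = -(inner ℝ z u * Real.exp (-‖z‖ ^ 2 / 2)) := by
  have h1 : HasFDerivAt (fun z : En n => -‖z‖ ^ 2 / 2) (-(innerSL ℝ z)) z := by
    have := ((hasStrictFDerivAt_norm_sq z).hasFDerivAt).const_mul (-(1 / 2) : ℝ)
    refine (this.congr_fderiv ?_).congr_of_eventuallyEq (.of_forall fun y => ?_)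
    · ext v
      simp
    · simp only
      ring
  rw [h1.exp.fderiv]
  simp
  ring

/-- Gaussian integration by parts. -/
lemma integral_coord_mul_gaussMeasure {f : En n → ℝ} (hf : ContDiff ℝ 1 f) {M : ℝ}
    (hM : ∀ z, |f z| ≤ M) (i : Fin n) (hM' : ∀ z, |fderiv ℝ f z (eb n i)| ≤ M) :
    ∫ z, z i * f z ∂gaussMeasure n = ∫ z, fderiv ℝ f z (eb n i) ∂gaussMeasure n := by
  have hd : Continuous fun z => fderiv ℝ f z (eb n i) :=
    (hf.continuous_fderiv one_ne_zero).clm_apply continuous_const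
  have hi : ∀ z : En n, inner ℝ z (eb n i) = z i := by
    intro z
    simp [eb, EuclideanSpace.inner_single_right]
  have h1 : Integrable (fun z => z i * f z) (gaussMeasure n) := by
    refine (integrable_norm_gaussMeasure.mul_const M).mono' ?_ (.of_forall fun z => ?_)
    · have := hf.continuous
      fun_prop
    · rw [norm_mul]
      gcongr
      · exact PiLp.norm_apply_le z i
      · exact hM z
  have h2 : Integrable (fun z => fderiv ℝ f z (eb n i)) (gaussMeasure n) :=
    (integrable_const M).mono' hd.aestronglyMeasurable (.of_forall hM')
  have h3 : Integrable f (gaussMeasure n) :=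
    (integrable_const M).mono' hf.continuous.aestronglyMeasurable (.of_forall hM)
  rw [integrable_gaussMeasure_iff] at h1 h2 h3
  rw [integral_gaussMeasure, integral_gaussMeasure,
    integral_mul_fderiv_eq_neg_fderiv_mul_of_integrable ?_ h2 h3 ?_ ?_, ← integral_neg]
  · refine integral_congr_ae (.of_forall fun z => ?_)
    simp only [fderiv_gaussWeight, hi]
    ring
  · refine h1.neg.congr (.of_forall fun z => ?_)
    simp only [fderiv_gaussWeight, hi, Pi.neg_apply]
    ring
  · intro z _
    exact (((contDiff_norm_sq ℝ (n := 1)).neg.div_const 2).exp.differentiable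
      one_ne_zero).differentiableAt
  · exact fun z _ => (hf.differentiable one_ne_zero).differentiableAt

end Gaussian

section HeatAvg

variable {n : ℕ} {T : ℝ}

/-- The space-time measure of the backward heat kernel on a time interval of length `T`. -/
def heatMeasure (n : ℕ) (T : ℝ) : Measure (En n × ℝ) :=
  ((volume.restrict (Ioc 0 T)).prod (gaussMeasure n)).map
    fun q : ℝ × En n => (-(√(2 * q.1) • q.2), -q.1)

instance isFiniteMeasure_heatMeasure : IsFiniteMeasure (heatMeasure n T) := by
  unfold heatMeasure
  infer_instance

/-- The average of `g` against the backward heat kernel. -/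
def heatAvg (T : ℝ) (g : En n × ℝ → ℝ) (p : En n × ℝ) : ℝ := ∫ q, g (p - q) ∂heatMeasure n T

lemma integrable_comp_sub {E : Type*} [NormedAddCommGroup E] {g : En n × ℝ → E}
    (hg : Continuous g) (hs : HasCompactSupport g) (p : En n × ℝ) :
    Integrable (fun q => g (p - q)) (heatMeasure n T) := by
  obtain ⟨M, hM⟩ := hs.exists_bound_of_continuous hg
  have : Continuous fun q => g (p - q) := by fun_prop
  exact (integrable_const M).mono' this.aestronglyMeasurable (.of_forall fun q => hM _)

lemma heatAvg_eq {g : En n × ℝ → ℝ} (hg : Continuous g) (hs : HasCompactSupport g) (hT : 0 ≤ T)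
    (x : En n) (t : ℝ) :
    heatAvg T g (x, t)
      = ∫ s in (0 : ℝ)..T, ∫ z, g (x + √(2 * s) • z, t + s) ∂gaussMeasure n := by
  have hmap : Measurable fun q : ℝ × En n => (-(√(2 * q.1) • q.2), -q.1) := by fun_prop
  have hi := integrable_comp_sub (T := T) hg hs (x, t)
  rw [heatAvg, heatMeasure, integral_map hmap.aemeasurable (by fun_prop)]
  rw [heatMeasure, integrable_map_measure (by fun_prop) hmap.aemeasurable] at hi
  refine (integral_prod _ hi).trans ?_
  rw [intervalIntegral.integral_of_le hT]
  simp

lemma ContDiff.heatAvg {g : En n × ℝ → ℝ} (hg : ContDiff ℝ ∞ g) (hs : HasCompactSupport g) :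
    ContDiff ℝ ∞ (heatAvg T g) := by
  have h := hs.contDiff_convolution_right (μ := heatMeasure n T) (f := fun _ => (1 : ℝ))
    (ContinuousLinearMap.lsmul ℝ ℝ) (n := ⊤) (integrable_const _).locallyIntegrable hg
  convert h using 1
  funext p
  simp [_root_.heatAvg, convolution]

lemma dirDeriv_heatAvg {g : En n × ℝ → ℝ} (hg : ContDiff ℝ ∞ g) (hs : HasCompactSupport g)
    (u : En n × ℝ) : dirDeriv u (heatAvg T g) = heatAvg T (dirDeriv u g) := by
  funext p
  have hg' : Continuous (fderiv ℝ g) := hg.continuous_fderiv (by simp)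
  obtain ⟨M, hM⟩ := (hs.fderiv ℝ).exists_bound_of_continuous hg'
  have hi := integrable_comp_sub (T := T) hg' (hs.fderiv ℝ) p
  have h : HasFDerivAt (heatAvg T g) (∫ q, fderiv ℝ g (p - q) ∂heatMeasure n T) p := by
    refine hasFDerivAt_integral_of_dominated_of_fderiv_le (bound := fun _ => M)
      (F' := fun p q => fderiv ℝ g (p - q)) univ_mem
      (.of_forall fun p => (integrable_comp_sub hg.continuous hs p).aestronglyMeasurable)
      (integrable_comp_sub hg.continuous hs p) hi.aestronglyMeasurable
      (.of_forall fun q p _ => hM _) (integrable_const M) (.of_forall fun q p _ => ?_)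
    have h1 := ((hg.differentiable (by simp)).differentiableAt (x := p - q)).hasFDerivAt
    exact h1.comp p ((hasFDerivAt_id p).sub_const q)
  rw [dirDeriv, h.fderiv, ContinuousLinearMap.integral_apply hi]
  rfl

lemma heatOp_heatAvg {g : En n × ℝ → ℝ} (hg : ContDiff ℝ ∞ g) (hs : HasCompactSupport g)
    (p : En n × ℝ) : heatOp (heatAvg T g) p = heatAvg T (heatOp g) p := by
  simp only [heatOp, spDeriv, dirDeriv_heatAvg hg hs,
    dirDeriv_heatAvg (hg.dirDeriv _) (hs.dirDeriv _)]
  simp only [heatAvg, heatOp]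
  have h2 : ∀ i : Fin n, Integrable (fun q => dirDeriv (eb n i, (0 : ℝ))
      (dirDeriv (eb n i, (0 : ℝ)) g) (p - q)) (heatMeasure n T) := fun i =>
    integrable_comp_sub ((hg.dirDeriv _).dirDeriv _).continuous ((hs.dirDeriv _).dirDeriv _) p
  rw [integral_add (integrable_comp_sub (hg.dirDeriv _).continuous (hs.dirDeriv _) p)
    (integrable_finsetSum _ fun i _ => h2 i), integral_finsetSum _ fun i _ => h2 i]

lemma lintegral_heatAvg_slice_le {g : En n × ℝ → ℝ} (hg : Continuous g) {B : ℝ≥0∞}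
    (hB : ∀ t, ∫⁻ x, ‖g (x, t)‖ₑ ≤ B) (t : ℝ) :
    ∫⁻ x, ‖heatAvg T g (x, t)‖ₑ ≤ B * heatMeasure n T univ := by
  calc ∫⁻ x, ‖heatAvg T g (x, t)‖ₑ
      ≤ ∫⁻ x, ∫⁻ q, ‖g ((x, t) - q)‖ₑ ∂heatMeasure n T :=
        lintegral_mono fun x => enorm_integral_le_lintegral_enorm _
    _ = ∫⁻ q, (∫⁻ x, ‖g ((x, t) - q)‖ₑ) ∂heatMeasure n T := by
        refine lintegral_lintegral_swap (Measurable.aemeasurable ?_)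
        exact (Continuous.measurable (by fun_prop) :
          Measurable fun r : En n × (En n × ℝ) => g ((r.1, t) - r.2)).enorm
    _ ≤ ∫⁻ _, B ∂heatMeasure n T := by
        refine lintegral_mono fun q => ?_
        have := lintegral_sub_right_eq_self (μ := (volume : Measure (En n)))
          (fun x => ‖g (x, t - q.2)‖ₑ) q.1
        exact this.le.trans (hB _)
    _ = B * heatMeasure n T univ := lintegral_const _

lemma heatAvg_comp_isometry {g : En n × ℝ → ℝ} (hg : Continuous g) (hs : HasCompactSupport g)
    (hT : 0 ≤ T) (R : En n ≃ₗᵢ[ℝ] En n) (hR : ∀ x t, g (R x, t) = -g (x, t)) (x : En n) (t : ℝ) :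
    heatAvg T g (R x, t) = -heatAvg T g (x, t) := by
  rw [heatAvg_eq hg hs hT, heatAvg_eq hg hs hT, ← intervalIntegral.integral_neg]
  refine intervalIntegral.integral_congr fun s _ => ?_
  rw [← integral_gaussMeasure_comp_isometry R, ← integral_neg]
  refine integral_congr_ae (.of_forall fun z => ?_)
  simp only [← hR, map_add, map_smul]

end HeatAvg

section Duhamel

variable {n : ℕ} {T : ℝ}

lemma sum_smul_eb (z : En n) : ∑ i, z i • eb n i = z := by
  have h := (EuclideanSpace.basisFun (Fin n) ℝ).sum_repr z
  simpa [eb] using h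

lemma fderiv_prod_eq_sum (g : En n × ℝ → ℝ) (p : En n × ℝ) (c : ℝ) (z : En n) :
    fderiv ℝ g p (c • z, 1) = dirDeriv (0, 1) g p + c * ∑ i, z i * spDeriv i g p := by
  have h : ((c • z, 1) : En n × ℝ) = (0, 1) + c • ∑ i, z i • (eb n i, (0 : ℝ)) := by
    refine Prod.ext ?_ ?_
    · simp [Prod.fst_sum, sum_smul_eb]
    · simp [Prod.snd_sum]
  rw [h, map_add, map_smul, map_sum]
  simp only [map_smul, smul_eq_mul]
  rfl

lemma integrable_slice {g : En n × ℝ → ℝ} (hg : Continuous g) (hs : HasCompactSupport g)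
    (x : En n) (c t : ℝ) : Integrable (fun z => g (x + c • z, t)) (gaussMeasure n) := by
  obtain ⟨M, hM⟩ := hs.exists_bound_of_continuous hg
  have : Continuous fun z => g (x + c • z, t) := by fun_prop
  exact (integrable_const M).mono' this.aestronglyMeasurable (.of_forall fun q => hM _)

lemma integrable_coord_mul_slice {g : En n × ℝ → ℝ} (hg : Continuous g) (hs : HasCompactSupport g)
    (x : En n) (c t : ℝ) (i : Fin n) :
    Integrable (fun z => z i * g (x + c • z, t)) (gaussMeasure n) := by
  obtain ⟨M, hM⟩ := hs.exists_bound_of_continuous hg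
  have : Continuous fun z : En n => z i * g (x + c • z, t) := by fun_prop
  refine (integrable_norm_gaussMeasure.mul_const M).mono' this.aestronglyMeasurable
    (.of_forall fun z => ?_)
  rw [norm_mul]
  gcongr
  · exact PiLp.norm_apply_le z i
  · exact hM _

lemma integral_coord_mul_slice {g : En n × ℝ → ℝ} (hg : ContDiff ℝ ∞ g) (hs : HasCompactSupport g)
    (x : En n) (c t : ℝ) (i : Fin n) :
    ∫ z, z i * g (x + c • z, t) ∂gaussMeasure n
      = c * ∫ z, spDeriv i g (x + c • z, t) ∂gaussMeasure n := by
  have hd : ∀ z, fderiv ℝ (fun z => g (x + c • z, t)) z (eb n i)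
      = c * spDeriv i g (x + c • z, t) := by
    intro z
    have h1 : HasFDerivAt (fun z : En n => (x + c • z, t))
        ((c • ContinuousLinearMap.id ℝ (En n)).prod 0) z :=
      (((hasFDerivAt_id z).const_smul c).const_add x).prodMk (hasFDerivAt_const t z)
    have h2 := ((hg.differentiable (by simp)).differentiableAt (x := (x + c • z, t))).hasFDerivAt
    have h3 := (h2.comp z h1).fderiv
    simp only [Function.comp_def] at h3
    have h4 : ((c • eb n i, 0) : En n × ℝ) = c • (eb n i, (0 : ℝ)) := by simp
    rw [h3]
    change fderiv ℝ g (x + c • z, t) (c • eb n i, 0) = _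
    rw [h4, map_smul]
    rfl
  obtain ⟨M, hM⟩ := hs.exists_bound_of_continuous hg.continuous
  obtain ⟨N, hN⟩ := (hs.dirDeriv (eb n i, (0 : ℝ))).exists_bound_of_continuous
    (hg.dirDeriv _).continuous
  have hsm : ContDiff ℝ 1 fun z => g (x + c • z, t) :=
    (hg.of_le (by norm_cast)).comp
      ((contDiff_const.add (contDiff_id.const_smul c)).prodMk contDiff_const)
  rw [integral_coord_mul_gaussMeasure hsm (M := max M (|c| * N))
    (fun z => (hM _).trans (le_max_left _ _)) i (fun z => ?_)]
  · simp only [hd, integral_const_mul]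
  · rw [hd, abs_mul]
    exact (mul_le_mul_of_nonneg_left (hN _) (abs_nonneg _)).trans (le_max_right _ _)

lemma hasDerivAt_integral_slice {g : En n × ℝ → ℝ} (hg : ContDiff ℝ ∞ g)
    (hs : HasCompactSupport g) (x : En n) (t : ℝ) {s₀ : ℝ} (hs₀ : 0 < s₀) :
    HasDerivAt (fun s => ∫ z, g (x + √(2 * s) • z, t + s) ∂gaussMeasure n)
      (∫ z, heatOp g (x + √(2 * s₀) • z, t + s₀) ∂gaussMeasure n) s₀ := by
  have hg' : Continuous (fderiv ℝ g) := hg.continuous_fderiv (by simp)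
  obtain ⟨M, hM⟩ := (hs.fderiv ℝ).exists_bound_of_continuous hg'
  have hM0 : 0 ≤ M := (norm_nonneg _).trans (hM 0)
  have key := hasDerivAt_integral_of_dominated_loc_of_deriv_le (μ := gaussMeasure n)
    (bound := fun z => M * ((√s₀)⁻¹ * ‖z‖ + 1)) (s := Ioi (s₀ / 2)) (x₀ := s₀)
    (F := fun s z => g (x + √(2 * s) • z, t + s))
    (F' := fun s z => fderiv ℝ g (x + √(2 * s) • z, t + s) ((√(2 * s))⁻¹ • z, 1))
    (Ioi_mem_nhds (by linarith))
    (.of_forall fun s => (integrable_slice hg.continuous hs x _ _).aestronglyMeasurable)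
    (integrable_slice hg.continuous hs x _ _)
    (Continuous.aestronglyMeasurable (by fun_prop))
    (.of_forall fun z s hs' => ?_)
    (((integrable_norm_gaussMeasure.const_mul _).add (integrable_const _)).const_mul M)
    (.of_forall fun z s hs' => ?_)
  · refine key.2.congr_deriv (Eq.symm ?_)
    have h2 : ∀ i : Fin n, Integrable
        (fun z => z i * spDeriv i g (x + √(2 * s₀) • z, t + s₀)) (gaussMeasure n) := fun i =>
      integrable_coord_mul_slice (hg.dirDeriv _).continuous (hs.dirDeriv _) x _ _ i
    have h3 : ∀ i : Fin n, Integrable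
        (fun z => spDeriv i (spDeriv i g) (x + √(2 * s₀) • z, t + s₀)) (gaussMeasure n) := fun i =>
      integrable_slice ((hg.dirDeriv _).dirDeriv _).continuous ((hs.dirDeriv _).dirDeriv _) x _ _
    have h4 : Integrable
        (fun z => dirDeriv (0, 1) g (x + √(2 * s₀) • z, t + s₀)) (gaussMeasure n) :=
      integrable_slice (hg.dirDeriv _).continuous (hs.dirDeriv _) x _ _
    simp only [heatOp, fderiv_prod_eq_sum]
    rw [integral_add h4 (integrable_finsetSum _ fun i _ => h3 i),
      integral_add h4 ((integrable_finsetSum _ fun i _ => h2 i).const_mul _),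
      integral_finsetSum _ fun i _ => h3 i, integral_const_mul, integral_finsetSum _ fun i _ => h2 i]
    rw [Finset.sum_congr rfl fun i _ => integral_coord_mul_slice (hg.dirDeriv (eb n i, (0 : ℝ)))
      (hs.dirDeriv _) x (√(2 * s₀)) (t + s₀) i, ← Finset.mul_sum,
      inv_mul_cancel_left₀ (by positivity)]
  · have hs' : s₀ / 2 < s := hs'
    refine ((fderiv ℝ g _).le_opNorm _).trans ?_
    refine mul_le_mul (hM _) ?_ (norm_nonneg _) hM0
    rw [Prod.norm_mk, norm_one, norm_smul, norm_inv, Real.norm_eq_abs,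
      abs_of_nonneg (Real.sqrt_nonneg _)]
    have h5 : (√(2 * s))⁻¹ * ‖z‖ ≤ (√s₀)⁻¹ * ‖z‖ := by
      gcongr
      linarith
    exact max_le (h5.trans (by linarith)) (le_add_of_nonneg_left (by positivity))
  · have hs' : s₀ / 2 < s := hs'
    have hs1 : 0 < s := by linarith
    have h1 : HasDerivAt (fun s => √(2 * s)) (√(2 * s))⁻¹ s := by
      have := ((hasDerivAt_id' s).const_mul 2).sqrt (by positivity)
      convert this using 1
      field_simp
    have h2 : HasDerivAt (fun s => (x + √(2 * s) • z, t + s)) ((√(2 * s))⁻¹ • z, (1 : ℝ)) s :=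
      ((h1.smul_const z).const_add x).prodMk ((hasDerivAt_id' s).const_add t)
    have h3 := ((hg.differentiable (by simp)).differentiableAt
      (x := (x + √(2 * s) • z, t + s))).hasFDerivAt
    exact h3.comp_hasDerivAt s h2

lemma continuous_integral_slice {g : En n × ℝ → ℝ} (hg : Continuous g)
    (hs : HasCompactSupport g) (x : En n) (t : ℝ) :
    Continuous fun s => ∫ z, g (x + √(2 * s) • z, t + s) ∂gaussMeasure n := by
  obtain ⟨M, hM⟩ := hs.exists_bound_of_continuous hg
  exact continuous_of_dominated (bound := fun _ => M)
    (fun s => (integrable_slice hg hs x _ _).aestronglyMeasurable)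
    (fun s => .of_forall fun z => hM _) (integrable_const M) (.of_forall fun z => by fun_prop)

/-- Duhamel's formula: the Gaussian average inverts the backward heat operator. -/
lemma heatAvg_heatOp {g : En n × ℝ → ℝ} (hg : ContDiff ℝ ∞ g) (hs : HasCompactSupport g)
    (hT : 0 ≤ T) (hgT : ∀ x t, T ≤ t → g (x, t) = 0) (x : En n) {t : ℝ} (ht : 0 ≤ t) :
    heatAvg T (heatOp g) (x, t) = -(∫ _, (1 : ℝ) ∂gaussMeasure n) * g (x, t) := by
  rw [heatAvg_eq hg.heatOp.continuous hs.heatOp hT,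
    intervalIntegral.integral_eq_sub_of_hasDerivAt_of_le hT
      (continuous_integral_slice hg.continuous hs x t).continuousOn
      (fun s hs' => hasDerivAt_integral_slice hg hs x t hs'.1)
      ((continuous_integral_slice hg.heatOp.continuous hs.heatOp x t).intervalIntegrable _ _)]
  simp [hgT _ (t + T) (by linarith)]

lemma heatAvg_eq_zero_of_lt {g : En n × ℝ → ℝ} (hg : Continuous g) (hs : HasCompactSupport g)
    (hT : 0 ≤ T) {T' : ℝ} (hgT : ∀ x t, T' < t → g (x, t) = 0) (x : En n) {t : ℝ} (ht : T' < t) :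
    heatAvg T g (x, t) = 0 := by
  rw [heatAvg_eq hg hs hT]
  refine (intervalIntegral.integral_congr (g := fun _ => 0) fun s hs' => ?_).trans (by simp)
  rw [uIcc_of_le hT] at hs'
  simp [fun y => hgT y (t + s) (by linarith [hs'.1])]

end Duhamel

/-! ### Testing against non-compactly supported functions -/

section Cutoff

variable {n : ℕ}

lemma dirDeriv_comp_smul {F : Type*} [NormedAddCommGroup F] [NormedSpace ℝ F] (u : F) (f : F → ℝ)
    (r : ℝ) : dirDeriv u (fun p => f (r • p)) = fun p => r * dirDeriv u f (r • p) := by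
  funext p
  simp [dirDeriv, fderiv_comp_smul]

lemma heatOp_comp_smul {f : En n × ℝ → ℝ} (hf : ContDiff ℝ ∞ f) (r : ℝ) (p : En n × ℝ) :
    heatOp (fun q => f (r • q)) p
      = r * dirDeriv (0, 1) f (r • p) + r ^ 2 * ∑ i, spDeriv i (spDeriv i f) (r • p) := by
  have key : ∀ u, dirDeriv u (fun q => r * dirDeriv u f (r • q)) p
      = r ^ 2 * dirDeriv u (dirDeriv u f) (r • p) := by
    intro u
    have h1 : DifferentiableAt ℝ (fun q => dirDeriv u f (r • q)) p :=
      (((hf.dirDeriv u).comp (contDiff_const_smul r)).differentiable (by simp)).differentiableAt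
    have h2 := congrFun (dirDeriv_comp_smul u (dirDeriv u f) r) p
    rw [dirDeriv] at h2 ⊢
    rw [fderiv_const_mul h1, _root_.smul_apply, h2, smul_eq_mul]
    ring
  simp only [heatOp, spDeriv, dirDeriv_comp_smul, key, Finset.mul_sum]

variable {E : Type*} [NormedAddCommGroup E] [NormedSpace ℝ E] [MeasurableSpace E] [BorelSpace E]
  {μ : Measure E} {F h : E → ℝ}

lemma integrable_mul_comp_smul (hF : Integrable F μ) (hc : Continuous h)
    (hs : HasCompactSupport h) (r : ℝ) : Integrable (fun p => F p * h (r • p)) μ := by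
  obtain ⟨M, hM⟩ := hs.exists_bound_of_continuous hc
  exact hF.mul_bdd (hc.comp (continuous_const_smul r)).aestronglyMeasurable (.of_forall fun p => hM _)

lemma tendsto_integral_mul_comp_smul (hF : Integrable F μ) (hc : Continuous h)
    (hs : HasCompactSupport h) :
    Tendsto (fun r : ℝ => ∫ p, F p * h (r • p) ∂μ) (𝓝[>] 0) (𝓝 ((∫ p, F p ∂μ) * h 0)) := by
  obtain ⟨M, hM⟩ := hs.exists_bound_of_continuous hc
  have key : Continuous fun r : ℝ => ∫ p, F p * h (r • p) ∂μ := by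
    refine continuous_of_dominated (bound := fun p => ‖F p‖ * M)
      (fun r => (integrable_mul_comp_smul hF hc hs r).aestronglyMeasurable)
      (fun r => .of_forall fun p => ?_) (hF.norm.mul_const M)
      (.of_forall fun p => by fun_prop)
    rw [norm_mul]
    gcongr
    exact hM _
  have h0 := key.tendsto 0
  simp only [zero_smul, integral_mul_const] at h0
  exact h0.mono_left nhdsWithin_le_nhds

lemma integral_mul_heatOp_eq_zero_of_cutoff {μ : Measure (En n × ℝ)} {w φ : En n × ℝ → ℝ}
    (hφ : ContDiff ℝ ∞ φ) (h0 : Integrable (fun p => w p * φ p) μ)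
    (h1 : ∀ i, Integrable (fun p => w p * spDeriv i φ p) μ)
    (h2 : Integrable (fun p => w p * heatOp φ p) μ)
    (hcut : ∀ χ : En n × ℝ → ℝ, ContDiff ℝ ∞ χ → HasCompactSupport χ →
      ∫ p, w p * heatOp (fun q => χ q * φ q) p ∂μ = 0) :
    ∫ p, w p * heatOp φ p ∂μ = 0 := by
  let b : ContDiffBump (0 : En n × ℝ) := ⟨1, 2, one_pos, one_lt_two⟩
  have hb : ContDiff ℝ ∞ b := b.contDiff
  have hbs : HasCompactSupport b := b.hasCompactSupport
  have hb0 : b 0 = 1 := b.one_of_mem_closedBall (mem_closedBall_self zero_le_one)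
  have hL : Continuous fun p => ∑ i, spDeriv i (spDeriv i b) p :=
    continuous_finsetSum _ fun i _ => ((hb.dirDeriv _).dirDeriv _).continuous
  have hLs : HasCompactSupport fun p => ∑ i, spDeriv i (spDeriv i b) p := by
    refine HasCompactSupport.intro hbs.isCompact fun p hp => Finset.sum_eq_zero fun i _ => ?_
    exact image_eq_zero_of_notMem_tsupport fun h =>
      hp (tsupport_dirDeriv_subset _ _ (tsupport_dirDeriv_subset _ _ h))
  have hid : Tendsto (fun r : ℝ => r) (𝓝[>] 0) (𝓝 0) := nhdsWithin_le_nhds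
  have hlim := (((tendsto_integral_mul_comp_smul h2 hb.continuous hbs).add
    (hid.mul (tendsto_integral_mul_comp_smul h0 (hb.dirDeriv (0, 1)).continuous
      (hbs.dirDeriv _)))).add
    ((hid.pow 2).mul (tendsto_integral_mul_comp_smul h0 hL hLs))).add
    ((hid.const_mul 2).mul (tendsto_finsetSum Finset.univ fun i _ =>
      tendsto_integral_mul_comp_smul (h1 i) (hb.dirDeriv (eb n i, 0)).continuous (hbs.dirDeriv _)))
  simp only [hb0, mul_one, mul_zero, zero_mul, add_zero, ne_eq, OfNat.ofNat_ne_zero,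
    not_false_eq_true, zero_pow] at hlim
  refine tendsto_nhds_unique hlim ((tendsto_const_nhds (x := (0 : ℝ))).congr' ?_)
  filter_upwards [self_mem_nhdsWithin] with r hr
  have hr : r ≠ 0 := ne_of_gt hr
  have hχ : ContDiff ℝ ∞ fun p => b (r • p) := hb.comp (contDiff_const_smul r)
  refine (hcut _ hχ (hbs.comp_smul hr)).symm.trans ?_
  have i0 := integrable_mul_comp_smul h2 hb.continuous hbs r
  have i1 := (integrable_mul_comp_smul h0 (hb.dirDeriv (0, 1)).continuous
    (hbs.dirDeriv _) r).const_mul r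
  have i2 := (integrable_mul_comp_smul h0 hL hLs r).const_mul (r ^ 2)
  have i3 : ∀ i, Integrable (fun p => w p * spDeriv i φ p * spDeriv i b (r • p)) μ := fun i =>
    integrable_mul_comp_smul (h1 i) (hb.dirDeriv (eb n i, 0)).continuous (hbs.dirDeriv _) r
  have i4 := (integrable_finsetSum Finset.univ fun i _ => i3 i).const_mul (2 * r)
  rw [← integral_finsetSum _ fun i _ => i3 i, ← integral_const_mul, ← integral_const_mul,
    ← integral_const_mul, ← integral_add i0 i1, ← integral_add (i0.fun_add i1) i2,
    ← integral_add ((i0.fun_add i1).fun_add i2) i4]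
  refine integral_congr_ae (.of_forall fun p => ?_)
  simp only [heatOp_mul hχ hφ, heatOp_comp_smul hb, spDeriv, dirDeriv_comp_smul]
  have : ∑ i, r * dirDeriv (eb n i, (0 : ℝ)) b (r • p) * dirDeriv (eb n i, 0) φ p
      = r * ∑ i, dirDeriv (eb n i, (0 : ℝ)) b (r • p) * dirDeriv (eb n i, 0) φ p := by
    rw [Finset.mul_sum]
    exact Finset.sum_congr rfl fun i _ => by ring
  have h3 : ∑ i, w p * dirDeriv (eb n i, (0 : ℝ)) φ p * dirDeriv (eb n i, 0) b (r • p)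
      = w p * ∑ i, dirDeriv (eb n i, (0 : ℝ)) b (r • p) * dirDeriv (eb n i, 0) φ p := by
    rw [Finset.mul_sum]
    exact Finset.sum_congr rfl fun i _ => by ring
  rw [this, h3]
  ring

end Cutoff

section Uniqueness

variable {n : ℕ} {hn : 2 ≤ n} {T γ C : ℝ} {w : En n × ℝ → ℝ}

/-- The reflection of `ℝⁿ` across the hyperplane `xₙ = 0`. -/
def lastReflection (n : ℕ) (hn : 2 ≤ n) : En n ≃ₗᵢ[ℝ] En n :=
  (ℝ ∙ eb n (lastIdx n hn))ᗮ.reflection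

lemma lastReflection_apply (x : En n) :
    lastReflection n hn x = x - (2 * xlast n hn x) • eb n (lastIdx n hn) := by
  have h : inner ℝ (eb n (lastIdx n hn)) x = xlast n hn x := by
    simp [eb, xlast, EuclideanSpace.inner_single_left]
  rw [lastReflection, Submodule.reflection_orthogonal_apply, Submodule.reflection_singleton_apply,
    h, norm_eb]
  simp [two_smul, two_mul, add_smul]

lemma lastReflection_lastReflection (x : En n) :
    lastReflection n hn (lastReflection n hn x) = x :=
  Submodule.reflection_reflection _ x

lemma xlast_lastReflection (x : En n) :
    xlast n hn (lastReflection n hn x) = -xlast n hn x := by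
  rw [lastReflection_apply, sub_eq_add_neg, ← neg_smul, xlast_add_smul]
  ring

lemma integrableOn_mul_heatAvg (hγ1 : γ < 1) (hT : 0 < T) (hw : Measurable w)
    (hb : ∀ p ∈ halfCyl n hn T, |w p| ≤ C * p.2 ^ (-γ)) {g : En n × ℝ → ℝ}
    (hg : ContDiff ℝ ∞ g) (hs : HasCompactSupport g) :
    IntegrableOn (fun p => w p * heatAvg T g p) (halfCyl n hn T) := by
  obtain ⟨B, hB, h⟩ := exists_lintegral_slice_le hg.continuous hs
  exact integrableOn_mul_of_lintegral_slice_le hγ1 hT hw hb (hg.heatAvg hs).continuous.measurable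
    (ENNReal.mul_ne_top hB (measure_ne_top _ _)) (lintegral_heatAvg_slice_le hg.continuous h)

lemma integral_mul_heatOp_heatAvg_eq_zero (hγ1 : γ < 1) (hT : 0 < T) (hw : Measurable w)
    (hC : 0 ≤ C) (hb : ∀ p ∈ halfCyl n hn T, |w p| ≤ C * p.2 ^ (-γ))
    (hlim : ∀ p ∈ halfCyl n hn T, Tendsto (fun ε => w (scaleLast hn ε p)) (𝓝[>] 0) (𝓝 0))
    (hweak : ∀ φ : En n × ℝ → ℝ, ContDiff ℝ ∞ φ → HasCompactSupport φ →
      tsupport φ ⊆ openHalf n hn ×ˢ Iio T → ∫ p in halfCyl n hn T, w p * heatOp φ p = 0)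
    {g : En n × ℝ → ℝ} (hg : ContDiff ℝ ∞ g) (hs : HasCompactSupport g)
    (hodd : ∀ x t, g (lastReflection n hn x, t) = -g (x, t))
    {T' : ℝ} (hT' : T' < T) (hgT : ∀ x t, T' < t → g (x, t) = 0) :
    ∫ p in halfCyl n hn T, w p * heatOp (heatAvg T g) p = 0 := by
  have hφ : ContDiff ℝ ∞ (heatAvg T g) := hg.heatAvg hs
  refine integral_mul_heatOp_eq_zero_of_cutoff hφ
    (integrableOn_mul_heatAvg hγ1 hT hw hb hg hs) (fun i => ?_) ?_ fun χ hχ hχs => ?_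
  · simp only [spDeriv, dirDeriv_heatAvg hg hs]
    exact integrableOn_mul_heatAvg hγ1 hT hw hb (hg.dirDeriv _) (hs.dirDeriv _)
  · simp only [heatOp_heatAvg hg hs]
    exact integrableOn_mul_heatAvg hγ1 hT hw hb hg.heatOp hs.heatOp
  · refine integral_mul_heatOp_eq_zero_of_vanishing hγ1 hT hw hC hb hlim hweak (hχ.mul hφ)
      hχs.mul_right (fun p hp => lt_of_le_of_lt ?_ hT') fun p hp => ?_
    · have hsub : tsupport (fun p => χ p * heatAvg T g p) ⊆ {p | p.2 ≤ T'} := by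
        refine closure_minimal (fun q hq => ?_) (isClosed_le continuous_snd continuous_const)
        by_contra hlt
        exact hq (by simp [heatAvg_eq_zero_of_lt hg.continuous hs hT.le hgT q.1 (not_le.1 hlt)])
      exact hsub hp
    · have h1 := heatAvg_comp_isometry hg.continuous hs hT.le (lastReflection n hn) hodd p.1 p.2
      rw [lastReflection_apply, hp] at h1
      have h2 : heatAvg T g p = 0 := by
        simp only [mul_zero, zero_smul, sub_zero, Prod.mk.eta] at h1
        linarith
      simp [h2]

lemma integral_mul_eq_zero_of_heat_weak (hγ1 : γ < 1) (hT : 0 < T) (hw : Measurable w)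
    (hC : 0 ≤ C) (hb : ∀ p ∈ halfCyl n hn T, |w p| ≤ C * p.2 ^ (-γ))
    (hlim : ∀ p ∈ halfCyl n hn T, Tendsto (fun ε => w (scaleLast hn ε p)) (𝓝[>] 0) (𝓝 0))
    (hweak : ∀ φ : En n × ℝ → ℝ, ContDiff ℝ ∞ φ → HasCompactSupport φ →
      tsupport φ ⊆ openHalf n hn ×ˢ Iio T → ∫ p in halfCyl n hn T, w p * heatOp φ p = 0)
    {ψ : En n × ℝ → ℝ} (hψ : ContDiff ℝ ∞ ψ) (hs : HasCompactSupport ψ)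
    (hsD : tsupport ψ ⊆ halfCyl n hn T) :
    ∫ p in halfCyl n hn T, w p * ψ p = 0 := by
  let R := lastReflection n hn
  obtain ⟨T', hT'0, hT'⟩ : ∃ T' < T, ∀ p ∈ tsupport ψ, p.2 ≤ T' := by
    rcases (tsupport ψ).eq_empty_or_nonempty with he | hne
    · exact ⟨0, hT, by simp [he]⟩
    · obtain ⟨p, hp, hmax⟩ := hs.isCompact.exists_isMaxOn hne continuous_snd.continuousOn
      exact ⟨p.2, (hsD hp).2.2, hmax⟩
  have hψ0 : ∀ x t, T' < t → ψ (x, t) = 0 := fun x t ht =>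
    image_eq_zero_of_notMem_tsupport fun h => (hT' _ h).not_gt ht
  let Φ : En n × ℝ ≃ₜ En n × ℝ := R.toHomeomorph.prodCongr (Homeomorph.refl ℝ)
  have hRψ : ContDiff ℝ ∞ fun p : En n × ℝ => ψ (R p.1, p.2) :=
    hψ.comp ((R.contDiff.comp contDiff_fst).prodMk contDiff_snd)
  have hg : ContDiff ℝ ∞ fun p : En n × ℝ => ψ p - ψ (R p.1, p.2) := hψ.sub hRψ
  have hgs : HasCompactSupport fun p : En n × ℝ => ψ p - ψ (R p.1, p.2) :=
    hs.sub (hs.comp_homeomorph Φ)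
  have hgT : ∀ x t, T' < t → ψ (x, t) - ψ (R x, t) = 0 := fun x t ht => by
    rw [hψ0 _ _ ht, hψ0 _ _ ht, sub_zero]
  have h := integral_mul_heatOp_heatAvg_eq_zero hγ1 hT hw hC hb hlim hweak hg hgs
    (fun x t => by simp only [R, lastReflection_lastReflection, neg_sub]) hT'0 hgT
  have hD := (isOpen_halfCyl hn T).measurableSet
  have heq : ∀ p ∈ halfCyl n hn T,
      w p * heatOp (heatAvg T fun p : En n × ℝ => ψ p - ψ (R p.1, p.2)) p
        = -(∫ _, (1 : ℝ) ∂gaussMeasure n) * (w p * ψ p) := by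
    intro p hp
    have hR : ψ (R p.1, p.2) = 0 := by
      refine image_eq_zero_of_notMem_tsupport fun h => ?_
      have h1 : 0 < xlast n hn (R p.1) := (hsD h).1
      have h2 : 0 < xlast n hn p.1 := hp.1
      rw [xlast_lastReflection] at h1
      linarith
    rw [heatOp_heatAvg hg hgs, ← Prod.mk.eta (p := p),
      heatAvg_heatOp hg hgs hT.le (fun x t ht => hgT x t (hT'0.trans_le ht)) p.1 hp.2.1.le]
    simp only [Prod.mk.eta, hR]
    ring
  rw [setIntegral_congr_fun hD heq, integral_const_mul] at h
  exact (mul_eq_zero.1 h).resolve_left (neg_ne_zero.2 integral_one_gaussMeasure_pos.ne')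

end Uniqueness

/-- **Lemma B.2**: uniqueness for the heat equation in a half space with zero
Dirichlet boundary condition, under the weighted bound `t^γ ‖v(·,t)‖_∞` with
`γ < 1`. -/
theorem heat_uniqueness_halfspace
    (n : ℕ) (hn : 2 ≤ n) (T γ : ℝ) (hT : 0 < T) (hγ0 : 0 ≤ γ) (hγ1 : γ < 1)
    (v : En n → ℝ → ℝ)
    (hmeas : Measurable (fun p : En n × ℝ => v p.1 p.2))
    (hloc : LocallyIntegrableOn (fun p : En n × ℝ => v p.1 p.2)
        (closedHalf n hn ×ˢ Ioo 0 T))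
    -- v(·,t) is continuous on the closed half space for each t
    (hcont : ∀ t ∈ Ioo (0 : ℝ) T, ContinuousOn (fun x => v x t) (closedHalf n hn))
    -- v(x',0,t) = 0
    (hbc : ∀ t ∈ Ioo (0 : ℝ) T, ∀ x : En n, xlast n hn x = 0 → v x t = 0)
    -- sup_{0<t<T} t^γ sup_{ℝⁿ₊} |v(·,t)| < ∞
    (hbd : ∃ C : ℝ, ∀ t ∈ Ioo (0 : ℝ) T, ∀ x ∈ openHalf n hn, t ^ γ * |v x t| ≤ C)
    -- the weak form ∫∫ v (∂ₜφ + Δφ) = 0 for φ compactly supported in ℝⁿ₊ × (−∞,T)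
    (hweak : ∀ φ : En n × ℝ → ℝ, ContDiff ℝ (⊤ : ℕ∞) φ → HasCompactSupport φ →
        tsupport φ ⊆ openHalf n hn ×ˢ Iio T →
        ∫ t in Ioo (0 : ℝ) T, ∫ x in openHalf n hn,
          v x t * (deriv (fun s => φ (x, s)) t + vlap (fun y => φ (y, t)) x) = 0) :
    ∀ᵐ p : En n × ℝ ∂(volume : Measure (En n × ℝ)),
      p.1 ∈ openHalf n hn → p.2 ∈ Ioo (0 : ℝ) T → v p.1 p.2 = 0 := by
  obtain ⟨C, hC⟩ := hbd
  set w : En n × ℝ → ℝ := fun p => v p.1 p.2 with hw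
  have hb : ∀ p ∈ halfCyl n hn T, |w p| ≤ |C| * p.2 ^ (-γ) := by
    rintro ⟨x, t⟩ ⟨hx, ht⟩
    have h1 := (hC t ht x hx).trans (le_abs_self C)
    have h2 : 0 < t ^ γ := Real.rpow_pos_of_pos ht.1 γ
    rw [Real.rpow_neg ht.1.le, ← div_eq_mul_inv, le_div_iff₀ h2, mul_comm]
    exact h1
  have hlim : ∀ p ∈ halfCyl n hn T,
      Tendsto (fun ε => w (scaleLast hn ε p)) (𝓝[>] 0) (𝓝 0) := by
    rintro ⟨x, t⟩ ⟨hx, ht⟩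
    have hx : 0 < xlast n hn x := hx
    have h0 : xlast n hn (scaleLast hn 0 (x, t)).1 = 0 := by rw [xlast_scaleLast, zero_mul]
    have h1 : Tendsto (fun ε => (scaleLast hn ε (x, t)).1) (𝓝[>] 0)
        (𝓝[closedHalf n hn] (scaleLast hn 0 (x, t)).1) := by
      refine tendsto_nhdsWithin_iff.2 ⟨?_, ?_⟩
      · simp only [scaleLast_apply]
        refine (Continuous.tendsto ?_ 0).mono_left nhdsWithin_le_nhds
        fun_prop
      · filter_upwards [self_mem_nhdsWithin] with ε hε
        have hε : 0 < ε := hε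
        simp only [closedHalf, mem_ofPred_eq, xlast_scaleLast]
        positivity
    have h2 := (hcont t ht _ (show _ ∈ closedHalf n hn from h0.ge)).tendsto.comp h1
    rw [hbc t ht _ h0] at h2
    refine h2.congr fun ε => ?_
    simp [hw, scaleLast_apply]
  have hweak' : ∀ φ : En n × ℝ → ℝ, ContDiff ℝ ∞ φ → HasCompactSupport φ →
      tsupport φ ⊆ openHalf n hn ×ˢ Iio T → ∫ p in halfCyl n hn T, w p * heatOp φ p = 0 := by
    intro φ hφ hs hsub
    have hi := integrableOn_mul_of_hasCompactSupport hγ1 hT hmeas hb hφ.heatOp.continuous hs.heatOp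
    rw [IntegrableOn, volume_restrict_halfCyl] at hi
    have h := hweak φ hφ hs hsub
    simp only [heatOp_eq hφ] at h
    rw [volume_restrict_halfCyl, integral_prod_symm _ hi]
    exact h
  have hsub : halfCyl n hn T ⊆ closedHalf n hn ×ˢ Ioo 0 T :=
    prod_mono (fun x hx => le_of_lt (show 0 < xlast n hn x from hx)) subset_rfl
  have hae := (isOpen_halfCyl hn T).ae_eq_zero_of_integral_contDiff_smul_eq_zero
    (hloc.mono_set hsub) fun ψ hψ hs hsD => by
      have h := integral_mul_eq_zero_of_heat_weak hγ1 hT hmeas (abs_nonneg C) hb hlim hweak'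
        hψ hs hsD
      rw [setIntegral_eq_integral_of_forall_compl_eq_zero fun p hp => by
        rw [image_eq_zero_of_notMem_tsupport fun h => hp (hsD h), mul_zero]] at h
      rw [← h]
      exact integral_congr_ae (.of_forall fun p => mul_comm _ _)
  filter_upwards [hae] with p hp hx ht using hp ⟨hx, ht⟩
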